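/- The second derivative of d is strictly negative throughout the interval [5.72, 6]; that is, d is strictly concave there: d''(t) < 0 for all t with 5.72 ≤ t ≤ 6. -/

import Mathlib

open MeasureTheory

/-- `G₊(x) = |1 + e(x) + e(7x)|² = 3 + 2(cos 2πx + cos 12πx + cos 14πx)`. -/
noncomputable def Gp (x : ℝ) : ℝ :=
  3 + 2 * (Real.cos (2 * Real.pi * x) + Real.cos (12 * Real.pi * x) + Real.cos (14 * Real.pi * x))

/-- `G₋(x) = |1 + e(x) − e(7x)|² = 3 + 2(cos 2πx − cos 12πx − cos 14πx)`. -/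
noncomputable def Gm (x : ℝ) : ℝ :=
  3 + 2 * (Real.cos (2 * Real.pi * x) - Real.cos (12 * Real.pi * x) - Real.cos (14 * Real.pi * x))

/-- `d(t) = ∫₀^{1/2} (G₋ᵗ − G₊ᵗ)`, real powers (`0^t = 0` for `t ≠ 0`). -/
noncomputable def d (t : ℝ) : ℝ := ∫ x in (0:ℝ)..(1/2), (Gm x ^ t - Gp x ^ t)

open Real

/-- The common form of `Gp` (`σ = 1`) and `Gm` (`σ = -1`). -/
noncomputable def signedG (σ : ℤ) (x : ℝ) : ℝ :=
  3 + 2 * (cos (2 * π * x) + σ * cos (12 * π * x) + σ * cos (14 * π * x))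

theorem signedG_one : signedG 1 = Gp := by
  ext x; simp [signedG, Gp]

theorem signedG_neg_one : signedG (-1) = Gm := by
  ext x; simp only [signedG, Gm]; push_cast; ring

theorem continuous_signedG (σ : ℤ) : Continuous (signedG σ) := by
  unfold signedG; fun_prop

theorem signedG_pos {σ : ℤ} (hσ : σ ^ 2 = 1) (x : ℝ) : 0 < signedG σ x := by
  have hσ' : (σ : ℝ) ^ 2 = 1 := by exact_mod_cast hσ
  set A := 2 * π * x with hA
  have h6 : cos (12 * π * x) = cos (7 * A) * cos A + sin (7 * A) * sin A := by
    rw [← cos_sub]; congr 1; rw [hA]; ring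
  have h7 : cos (14 * π * x) = cos (7 * A) := by congr 1; rw [hA]; ring
  have e1 := sin_sq_add_cos_sq A
  have e7 := sin_sq_add_cos_sq (7 * A)
  have hG : signedG σ x = (1 + cos A + σ * cos (7 * A)) ^ 2 + (sin A + σ * sin (7 * A)) ^ 2 := by
    rw [signedG, ← hA, h6, h7]
    linear_combination (-1 : ℝ) * e1 - e7 - (sin (7 * A) ^ 2 + cos (7 * A) ^ 2) * hσ'
  have hnn : 0 ≤ signedG σ x := by rw [hG]; positivity
  refine lt_of_le_of_ne hnn fun h0 => ?_
  rw [hG] at h0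
  have hc : 1 + cos A + σ * cos (7 * A) = 0 := by nlinarith
  have hs : sin A + σ * sin (7 * A) = 0 := by nlinarith
  have hcos : cos A = -1 / 2 := by
    linear_combination (-1/2 : ℝ) * e1 + (1/2 : ℝ) * e7
      + (1/2 : ℝ) * (1 + cos A - σ * cos (7 * A)) * hc
      + (1/2 : ℝ) * (sin A - σ * sin (7 * A)) * hs
      + (1/2 : ℝ) * (cos (7 * A) ^ 2 + sin (7 * A) ^ 2) * hσ'
  have h3 : cos (3 * A) = 1 := by rw [cos_three_mul, hcos]; norm_num
  have h6' : cos (7 * A) * cos A + sin (7 * A) * sin A = 1 := by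
    rw [← cos_sub, show 7 * A - A = 2 * (3 * A) by ring, cos_two_mul, h3]; norm_num
  have hhalf : (σ : ℝ) * (cos (7 * A) * cos A + sin (7 * A) * sin A) = -(1 / 2) := by
    linear_combination cos A * hc + sin A * hs - e1 - hcos
  rw [h6'] at hhalf
  nlinarith

theorem signedG_le {σ : ℤ} (hσ : σ = 1 ∨ σ = -1) (x : ℝ) : signedG σ x ≤ 9 := by
  have h1 := cos_le_one (2 * π * x)
  have h2 := abs_le.1 (abs_cos_le_one (12 * π * x))
  have h3 := abs_le.1 (abs_cos_le_one (14 * π * x))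
  rcases hσ with rfl | rfl <;> simp only [signedG] <;> push_cast <;> linarith

/-- The cosine sum `∑ i, l i * cos (2 π (o + i) x)` with coefficient list `l`. -/
noncomputable def cosSum : List ℤ → ℤ → ℝ → ℝ
  | [], _, _ => 0
  | c :: l, o, x => c * cos (2 * π * o * x) + cosSum l (o + 1) x

/-- Termwise addition of coefficient lists. -/
def addCoeffs : List ℤ → List ℤ → List ℤ
  | [], l => l
  | a :: l, [] => a :: l
  | a :: l, b :: l' => (a + b) :: addCoeffs l l'

/-- Coefficients of `x ↦ (signedG σ x - 6) * cosSum l o x` from offset `o - 7` on. -/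
def mulSignedG (σ : ℤ) (l : List ℤ) : List ℤ :=
  let m := l.map (σ * ·)
  addCoeffs (addCoeffs m (0 :: m)) <|
    List.replicate 6 0 ++ addCoeffs (addCoeffs l (0 :: l.map (-3 * ·)))
      (0 :: 0 :: addCoeffs l (List.replicate 5 0 ++ addCoeffs m (0 :: m)))

/-- Coefficients of `(signedG σ x - 6) ^ k` from offset `-7 k` on. -/
def powCoeffs (σ : ℤ) : ℕ → List ℤ
  | 0 => [1]
  | k + 1 => mulSignedG σ (powCoeffs σ k)

/-- The coefficient of frequency zero in a list starting at frequency `o`. -/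
def constCoeff : List ℤ → ℤ → ℤ
  | [], _ => 0
  | c :: l, o => (if o = 0 then c else 0) + constCoeff l (o + 1)

/-- Twice the integral of `(signedG σ - 6) ^ k` over `[0, 1/2]`. -/
def moment (σ : ℤ) (k : ℕ) : ℤ := constCoeff (powCoeffs σ k) (-7 * k)

theorem cosSum_addCoeffs (l l' : List ℤ) (o : ℤ) (x : ℝ) :
    cosSum (addCoeffs l l') o x = cosSum l o x + cosSum l' o x := by
  induction l generalizing l' o with
  | nil => simp [addCoeffs, cosSum]
  | cons a l ih =>
    cases l' with
    | nil => simp [addCoeffs, cosSum]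
    | cons b l' => simp only [addCoeffs, cosSum, ih]; push_cast; ring

theorem cosSum_map_mul (c : ℤ) (l : List ℤ) (o : ℤ) (x : ℝ) :
    cosSum (l.map (c * ·)) o x = c * cosSum l o x := by
  induction l generalizing o with
  | nil => simp [cosSum]
  | cons a l ih => simp only [List.map_cons, cosSum, ih]; push_cast; ring

theorem cosSum_zero_cons (l : List ℤ) (o : ℤ) (x : ℝ) :
    cosSum (0 :: l) o x = cosSum l (o + 1) x := by
  simp [cosSum]

theorem cosSum_replicate_append (n : ℕ) (l : List ℤ) (o : ℤ) (x : ℝ) :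
    cosSum (List.replicate n 0 ++ l) o x = cosSum l (o + n) x := by
  induction n generalizing o with
  | zero => simp
  | succ n ih =>
    rw [List.replicate_succ, List.cons_append, cosSum_zero_cons, ih]
    congr 1; push_cast; ring

theorem two_cos_mul_cosSum (a : ℤ) (l : List ℤ) (o : ℤ) (x : ℝ) :
    2 * cos (2 * π * a * x) * cosSum l o x = cosSum l (o + a) x + cosSum l (o - a) x := by
  induction l generalizing o with
  | nil => simp [cosSum]
  | cons c l ih =>
    have h1 := ih (o + 1)
    have h2 : 2 * cos (2 * π * a * x) * cos (2 * π * o * x)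
        = cos (2 * π * (o + a : ℤ) * x) + cos (2 * π * (o - a : ℤ) * x) := by
      rw [two_mul_cos_mul_cos, add_comm]
      congr 1
      · congr 1; push_cast; ring
      · rw [← cos_neg]; congr 1; push_cast; ring
    simp only [cosSum]
    rw [show o + a + 1 = o + 1 + a by ring, show o - a + 1 = o + 1 - a by ring]
    linear_combination (c : ℝ) * h2 + h1

theorem signedG_sub_mul_cosSum (σ : ℤ) (l : List ℤ) (o : ℤ) (x : ℝ) :
    (signedG σ x - 6) * cosSum l o x = cosSum (mulSignedG σ l) (o - 7) x := by
  have h1 := two_cos_mul_cosSum 1 l o x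
  have h6 := two_cos_mul_cosSum 6 l o x
  have h7 := two_cos_mul_cosSum 7 l o x
  simp only [mulSignedG, cosSum_addCoeffs, cosSum_zero_cons, cosSum_replicate_append,
    cosSum_map_mul]
  push_cast at h1 h6 h7 ⊢
  rw [show 2 * π * 1 * x = 2 * π * x by ring] at h1
  rw [show 2 * π * 6 * x = 12 * π * x by ring] at h6
  rw [show 2 * π * 7 * x = 14 * π * x by ring] at h7
  rw [signedG]
  ring_nf at h1 h6 h7 ⊢
  linear_combination h1 + σ * h6 + σ * h7

theorem signedG_sub_pow (σ : ℤ) (k : ℕ) (x : ℝ) :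
    (signedG σ x - 6) ^ k = cosSum (powCoeffs σ k) (-7 * k) x := by
  induction k with
  | zero => simp [powCoeffs, cosSum]
  | succ k ih =>
    rw [pow_succ', ih, signedG_sub_mul_cosSum, powCoeffs]
    congr 1; push_cast; ring

theorem continuous_cosSum (l : List ℤ) (o : ℤ) : Continuous (cosSum l o) := by
  induction l generalizing o with
  | nil => exact continuous_const
  | cons c l ih =>
    have := ih (o + 1)
    change Continuous fun x => (c : ℝ) * cos (2 * π * o * x) + cosSum l (o + 1) x
    fun_prop

theorem integral_cos_int (o : ℤ) :
    ∫ x in (0:ℝ)..(1/2), cos (2 * π * o * x) = if o = 0 then 1 / 2 else 0 := by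
  split_ifs with h
  · simp [h]
  · have ho : (2 * π * o : ℝ) ≠ 0 := by
      have : (o : ℝ) ≠ 0 := by exact_mod_cast h
      positivity
    rw [intervalIntegral.integral_comp_mul_left (fun y => cos y) ho, integral_cos]
    rw [show 2 * π * o * (1 / 2) = o * π by ring, sin_int_mul_pi]
    simp

theorem integral_cosSum (l : List ℤ) (o : ℤ) :
    ∫ x in (0:ℝ)..(1/2), cosSum l o x = constCoeff l o / 2 := by
  induction l generalizing o with
  | nil => simp [cosSum, constCoeff]
  | cons c l ih =>
    have hc := continuous_cosSum l (o + 1)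
    simp only [cosSum, constCoeff]
    rw [intervalIntegral.integral_add (Continuous.intervalIntegrable (by fun_prop) _ _)
      (hc.intervalIntegrable _ _), ih, intervalIntegral.integral_const_mul, integral_cos_int]
    split_ifs <;> push_cast <;> ring

theorem integral_signedG_sub_pow (σ : ℤ) (k : ℕ) :
    ∫ x in (0:ℝ)..(1/2), (signedG σ x - 6) ^ k = moment σ k / 2 := by
  simp_rw [signedG_sub_pow, integral_cosSum, moment]

/-- The values `moment (-1) k - moment 1 k` for `k < 27`. -/
def momentDiffs : List ℤ :=
  [0, 0, 0, 0, 0, 0, 0, -28, -32, 1584, -25800, 260040, -2270928, 17711408, -129273144,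
   895065600, -5962249280, 38470965728, -241848779328, 1486466759856, -8955890251200,
   52976982721880, -307947614969720, 1759295914841520, -9872261355899360, 54332086740470000,
   -292464862060467200]

theorem moment_sub_moment : (List.range 27).map (fun k => moment (-1) k - moment 1 k) =
    momentDiffs := by
  decide +kernel

theorem moment_add_moment : moment (-1) 26 + moment 1 26 = 15353710942205813038 := by
  decide +kernel

/-- `∏ i < j, (1 + s / (i + 1))`. -/
noncomputable def risingProd : ℕ → ℝ → ℝ
  | 0, _ => 1
  | j + 1, s => risingProd j s * (1 + s / (j + 1))

/-- The first derivative of `risingProd j`. -/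
noncomputable def risingProd₁ : ℕ → ℝ → ℝ
  | 0, _ => 0
  | j + 1, s => risingProd₁ j s * (1 + s / (j + 1)) + risingProd j s / (j + 1)

/-- The second derivative of `risingProd j`. -/
noncomputable def risingProd₂ : ℕ → ℝ → ℝ
  | 0, _ => 0
  | j + 1, s => risingProd₂ j s * (1 + s / (j + 1)) + 2 * risingProd₁ j s / (j + 1)

theorem hasDerivAt_risingProd (j : ℕ) (s : ℝ) :
    HasDerivAt (risingProd j) (risingProd₁ j s) s := by
  induction j with
  | zero => exact hasDerivAt_const s 1
  | succ j ih =>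
    have h := ih.mul (((hasDerivAt_id s).div_const ((j : ℝ) + 1)).const_add 1)
    refine h.congr_deriv ?_
    simp only [risingProd₁, id]; ring

theorem hasDerivAt_risingProd₁ (j : ℕ) (s : ℝ) :
    HasDerivAt (risingProd₁ j) (risingProd₂ j s) s := by
  induction j with
  | zero => exact hasDerivAt_const s 0
  | succ j ih =>
    have h := (ih.mul (((hasDerivAt_id s).div_const ((j : ℝ) + 1)).const_add 1)).add
      ((hasDerivAt_risingProd j s).div_const ((j : ℝ) + 1))
    refine h.congr_deriv ?_
    simp only [risingProd₂, id]; ring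

theorem abs_one_add_div_le {s : ℝ} (hs : |s| ≤ 3 / 10) (j : ℕ) :
    |1 + s / (j + 1)| ≤ (j + 13 / 10) / (j + 1) := by
  have hj : (0 : ℝ) < j + 1 := by positivity
  rw [one_add_div hj.ne', abs_div, abs_of_pos hj]
  gcongr
  rw [abs_le] at hs ⊢
  constructor <;> linarith [hs.1, hs.2, (Nat.cast_nonneg j : (0 : ℝ) ≤ j)]

theorem abs_risingProd_le {s : ℝ} (hs : |s| ≤ 3 / 10) (j : ℕ) :
    |risingProd j s| ≤ j + 1 := by
  induction j with
  | zero => simp [risingProd]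
  | succ j ih =>
    have hj : (0 : ℝ) < j + 1 := by positivity
    rw [risingProd, abs_mul]
    calc _ ≤ ((j : ℝ) + 1) * ((j + 13 / 10) / (j + 1)) := by
            gcongr; exact abs_one_add_div_le hs j
      _ = j + 13 / 10 := by field_simp
      _ ≤ _ := by push_cast; linarith

theorem abs_risingProd₁_le {s : ℝ} (hs : |s| ≤ 3 / 10) (j : ℕ) :
    |risingProd₁ j s| ≤ 10 / 7 * (j + 1) := by
  induction j with
  | zero => norm_num [risingProd₁]
  | succ j ih =>
    have hj : (0 : ℝ) < j + 1 := by positivity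
    rw [risingProd₁]
    refine (abs_add_le _ _).trans ?_
    rw [abs_mul, abs_div, abs_of_pos hj]
    calc _ ≤ 10 / 7 * ((j : ℝ) + 1) * ((j + 13 / 10) / (j + 1)) + (j + 1) / (j + 1) := by
            gcongr
            · exact abs_one_add_div_le hs j
            · exact abs_risingProd_le hs j
      _ = 10 / 7 * (j + 13 / 10) + 1 := by field_simp
      _ ≤ _ := by push_cast; linarith

theorem abs_risingProd₂_le {s : ℝ} (hs : |s| ≤ 3 / 10) (j : ℕ) :
    |risingProd₂ j s| ≤ 200 / 49 * (j + 1) := by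
  induction j with
  | zero => norm_num [risingProd₂]
  | succ j ih =>
    have hj : (0 : ℝ) < j + 1 := by positivity
    rw [risingProd₂]
    refine (abs_add_le _ _).trans ?_
    rw [abs_mul, abs_div, abs_of_pos hj, abs_mul, abs_two]
    calc _ ≤ 200 / 49 * ((j : ℝ) + 1) * ((j + 13 / 10) / (j + 1))
              + 2 * (10 / 7 * (j + 1)) / (j + 1) := by
            gcongr
            · exact abs_one_add_div_le hs j
            · exact abs_risingProd₁_le hs j
      _ = 200 / 49 * (j + 13 / 10) + 20 / 7 := by field_simp; ring
      _ ≤ _ := by push_cast; linarith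

theorem risingProd_mono {s s' : ℝ} (hs : 0 ≤ s) (h : s ≤ s') (j : ℕ) :
    0 ≤ risingProd j s ∧ risingProd j s ≤ risingProd j s' := by
  induction j with
  | zero => simp [risingProd]
  | succ j ih =>
    obtain ⟨h0, h1⟩ := ih
    simp only [risingProd]
    exact ⟨by positivity, by gcongr; linarith⟩

theorem risingProd₁_mono {s s' : ℝ} (hs : 0 ≤ s) (h : s ≤ s') (j : ℕ) :
    0 ≤ risingProd₁ j s ∧ risingProd₁ j s ≤ risingProd₁ j s' := by
  induction j with
  | zero => simp [risingProd₁]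
  | succ j ih =>
    obtain ⟨h0, h1⟩ := ih
    obtain ⟨h2, h3⟩ := risingProd_mono hs h j
    simp only [risingProd₁]
    exact ⟨by positivity, by gcongr; linarith⟩

theorem risingProd₂_mono {s s' : ℝ} (hs : 0 ≤ s) (h : s ≤ s') (j : ℕ) :
    0 ≤ risingProd₂ j s ∧ risingProd₂ j s ≤ risingProd₂ j s' := by
  induction j with
  | zero => simp [risingProd₂]
  | succ j ih =>
    obtain ⟨h0, h1⟩ := ih
    obtain ⟨h2, h3⟩ := risingProd₁_mono hs h j
    simp only [risingProd₂]
    exact ⟨by positivity, by gcongr; linarith⟩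

theorem succ_mul_choose_succ (t : ℝ) (k : ℕ) :
    ((k : ℝ) + 1) * Ring.choose t (k + 1) = Ring.choose t k * (t - k) := by
  rw [Ring.choose_eq_smul, Ring.choose_eq_smul, descPochhammer_succ_right,
    Polynomial.smeval_mul, Polynomial.smeval_sub, Polynomial.smeval_X,
    Polynomial.smeval_natCast, Nat.factorial_succ]
  have : ((k.factorial : ℕ) : ℝ) ≠ 0 := by positivity
  simp only [smul_eq_mul]
  push_cast
  field_simp
  simp

/-- `t (t - 1) ⋯ (t - 6)`. -/
noncomputable def fallingSeven (t : ℝ) : ℝ :=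
  t * (t - 1) * (t - 2) * (t - 3) * (t - 4) * (t - 5) * (t - 6)

/-- `j! / (j + 7)!`. -/
noncomputable def factRatio (j : ℕ) : ℝ := (j.factorial : ℝ) / ((j + 7).factorial : ℝ)

theorem factRatio_nonneg (j : ℕ) : 0 ≤ factRatio j := by unfold factRatio; positivity

theorem factRatio_succ (j : ℕ) : factRatio (j + 1) = factRatio j * ((j + 1) / (j + 8)) := by
  unfold factRatio
  rw [show j + 1 + 7 = (j + 7) + 1 by ring, Nat.factorial_succ, Nat.factorial_succ (j + 7)]
  have : (((j + 7).factorial : ℕ) : ℝ) ≠ 0 := by positivity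
  push_cast
  field_simp
  ring

theorem choose_add_seven (t : ℝ) (j : ℕ) :
    Ring.choose t (j + 7) =
      fallingSeven t * ((-1) ^ j * factRatio j * risingProd j (6 - t)) := by
  induction j with
  | zero =>
    have h1 := succ_mul_choose_succ t 1
    have h2 := succ_mul_choose_succ t 2
    have h3 := succ_mul_choose_succ t 3
    have h4 := succ_mul_choose_succ t 4
    have h5 := succ_mul_choose_succ t 5
    have h6 := succ_mul_choose_succ t 6
    norm_num at h1 h2 h3 h4 h5 h6
    simp only [fallingSeven, factRatio, risingProd, zero_add, Nat.factorial]
    norm_num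
    linear_combination (1/7 : ℝ) * h6 + (t - 6) / 42 * h5 + (t - 6) * (t - 5) / 210 * h4
      + (t - 6) * (t - 5) * (t - 4) / 840 * h3 + (t - 6) * (t - 5) * (t - 4) * (t - 3) / 2520 * h2
      + (t - 6) * (t - 5) * (t - 4) * (t - 3) * (t - 2) / 5040 * h1
  | succ j ih =>
    have h := succ_mul_choose_succ t (j + 7)
    rw [ih] at h
    have hj : (j : ℝ) + 8 ≠ 0 := by positivity
    have hj' : (j : ℝ) + 1 ≠ 0 := by positivity
    rw [factRatio_succ, risingProd, show j + 1 + 7 = j + 7 + 1 by ring]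
    push_cast at h
    apply mul_left_cancel₀ hj
    rw [show (j : ℝ) + 8 = j + 7 + 1 by ring, h, pow_succ]
    field_simp
    ring

/-- `(j + 1)! / (j + 6)! / 5`, whose decrements are `(j + 1) * factRatio j`. -/
noncomputable def factTail (j : ℕ) : ℝ := ((j + 1).factorial : ℝ) / ((j + 6).factorial : ℝ) / 5

theorem factTail_sub_succ (j : ℕ) :
    factTail j - factTail (j + 1) = factRatio j * (j + 1) := by
  unfold factTail factRatio
  rw [show j + 1 + 6 = (j + 6) + 1 by ring, show j + 7 = (j + 6) + 1 by ring,
    Nat.factorial_succ (j + 1), Nat.factorial_succ j, Nat.factorial_succ (j + 6)]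
  have : (((j + 6).factorial : ℕ) : ℝ) ≠ 0 := by positivity
  push_cast
  field_simp
  ring

theorem factTail_le (j : ℕ) : factTail j ≤ 1 / (j + 1) := by
  have h1 : (j + 1) * (j + 1).factorial ≤ (j + 6).factorial := by
    calc _ ≤ (j + 2) * (j + 1).factorial := by gcongr; omega
      _ = (j + 2).factorial := (Nat.factorial_succ (j + 1)).symm
      _ ≤ _ := Nat.factorial_le (by omega)
  have h2 : ((j : ℝ) + 1) * (j + 1).factorial ≤ (j + 6).factorial := by exact_mod_cast h1
  unfold factTail
  rw [div_div, div_le_div_iff₀ (by positivity) (by positivity)]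
  nlinarith [Nat.cast_nonneg (α := ℝ) (j + 6).factorial]

theorem tendsto_factTail : Filter.Tendsto factTail Filter.atTop (nhds 0) :=
  squeeze_zero (fun j => by unfold factTail; positivity) factTail_le
    tendsto_one_div_add_atTop_nhds_zero_nat

theorem hasSum_factRatio_mul (n : ℕ) :
    HasSum (fun j : ℕ => factRatio (j + n) * ((j + n : ℕ) + 1)) (factTail n) := by
  rw [hasSum_iff_tendsto_nat_of_nonneg fun j => mul_nonneg (factRatio_nonneg _) (by positivity)]
  have h : ∀ m, ∑ j ∈ Finset.range m, factRatio (j + n) * ((j + n : ℕ) + 1)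
      = factTail n - factTail (m + n) := by
    intro m
    induction m with
    | zero => simp
    | succ m ih =>
      rw [Finset.sum_range_succ, ih, ← factTail_sub_succ, show m + 1 + n = m + n + 1 by ring]
      ring
  simp_rw [h]
  simpa using ((Filter.tendsto_add_atTop_iff_nat n).2 tendsto_factTail).const_sub (factTail n)

/-- The difference of the integrals over `[0, 1/2]` of `(Gm / 6 - 1) ^ k` and `(Gp / 6 - 1) ^ k`. -/
noncomputable def momentDiff (k : ℕ) : ℝ := (moment (-1) k - moment 1 k) / (2 * 6 ^ k)

theorem abs_signedG_div_sub_one_lt {σ : ℤ} (hσ : σ = 1 ∨ σ = -1) (x : ℝ) :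
    |signedG σ x / 6 - 1| < 1 := by
  have h1 := signedG_pos (σ := σ) (by rcases hσ with rfl | rfl <;> norm_num) x
  have h2 := signedG_le hσ x
  rw [abs_lt]
  constructor <;> linarith

theorem integral_signedG_div_sub_one_pow (σ : ℤ) (k : ℕ) :
    ∫ x in (0:ℝ)..(1/2), (signedG σ x / 6 - 1) ^ k = moment σ k / (2 * 6 ^ k) := by
  have h : ∀ x, (signedG σ x / 6 - 1) ^ k = (signedG σ x - 6) ^ k / 6 ^ k := by
    intro x; rw [← div_pow]; congr 1; ring
  simp_rw [h]
  rw [intervalIntegral.integral_div, integral_signedG_sub_pow, div_div]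

theorem intervalIntegrable_signedG_div_sub_one_pow (σ : ℤ) (k : ℕ) :
    IntervalIntegrable (fun x => (signedG σ x / 6 - 1) ^ k) volume 0 (1 / 2) := by
  have := continuous_signedG σ
  exact Continuous.intervalIntegrable (by fun_prop) _ _

theorem momentDiff_eq_integral (k : ℕ) :
    ∫ x in (0:ℝ)..(1/2), ((signedG (-1) x / 6 - 1) ^ k - (signedG 1 x / 6 - 1) ^ k)
      = momentDiff k := by
  rw [intervalIntegral.integral_sub (intervalIntegrable_signedG_div_sub_one_pow _ _)
    (intervalIntegrable_signedG_div_sub_one_pow _ _), integral_signedG_div_sub_one_pow,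
    integral_signedG_div_sub_one_pow, momentDiff]
  ring

theorem abs_momentDiff_le {n k : ℕ} (hn : Even n) (hnk : n ≤ k) :
    |momentDiff k| ≤ (moment (-1) n + moment 1 n) / (2 * 6 ^ n) := by
  have hpow : ∀ {σ : ℤ}, (σ = 1 ∨ σ = -1) → ∀ x,
      |(signedG σ x / 6 - 1) ^ k| ≤ (signedG σ x / 6 - 1) ^ n := by
    intro σ hσ x
    rw [abs_pow, ← hn.pow_abs]
    exact pow_le_pow_of_le_one (abs_nonneg _) (abs_signedG_div_sub_one_lt hσ x).le hnk
  rw [← momentDiff_eq_integral, add_div, ← integral_signedG_div_sub_one_pow,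
    ← integral_signedG_div_sub_one_pow, ← intervalIntegral.integral_add
      (intervalIntegrable_signedG_div_sub_one_pow _ _)
      (intervalIntegrable_signedG_div_sub_one_pow _ _), ← Real.norm_eq_abs]
  refine intervalIntegral.norm_integral_le_of_norm_le (by norm_num) ?_
    ((intervalIntegrable_signedG_div_sub_one_pow _ _).add
      (intervalIntegrable_signedG_div_sub_one_pow _ _))
  refine Filter.Eventually.of_forall fun x _ => ?_
  rw [Real.norm_eq_abs]
  exact (abs_sub _ _).trans (add_le_add (hpow (.inr rfl) x) (hpow (.inl rfl) x))

theorem abs_momentDiff_le_one (k : ℕ) : |momentDiff k| ≤ 1 := by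
  refine (abs_momentDiff_le (n := 0) (by simp) (Nat.zero_le k)).trans ?_
  simp [moment, powCoeffs, constCoeff]

theorem hasSum_choose_mul_pow (t : ℝ) {w : ℝ} (hw : |w| < 1) :
    HasSum (fun k => Ring.choose t k * w ^ k) ((1 + w) ^ t) := by
  have h := (Real.one_add_rpow_hasFPowerSeriesOnBall_zero (a := t)).hasSum (y := w)
    (by simpa [Metric.mem_eball, edist_dist, Real.dist_eq] using hw)
  simp_rw [binomialSeries_apply] at h
  simpa using h

theorem norm_coeff_mul_le {j : ℕ} {p c : ℝ} (hp : |p| ≤ c * (j + 1)) :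
    ‖(-1) ^ j * factRatio j * momentDiff (j + 7) * p‖ ≤ c * (factRatio j * (j + 1)) := by
  have h1 := abs_momentDiff_le_one (j + 7)
  have h2 := factRatio_nonneg j
  rw [Real.norm_eq_abs, abs_mul, abs_mul, abs_mul, abs_pow, abs_neg, abs_one, one_pow, one_mul,
    abs_of_nonneg h2]
  calc _ ≤ factRatio j * 1 * (c * (j + 1)) := by gcongr
    _ = _ := by ring

theorem summable_factRatio_mul (c : ℝ) :
    Summable fun j : ℕ => c * (factRatio j * ((j : ℝ) + 1)) := by
  have := (hasSum_factRatio_mul 0).summable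
  simpa using this.mul_left c

theorem summable_abs_choose {t : ℝ} (ht : |6 - t| ≤ 3 / 10) :
    Summable fun k => |Ring.choose t k| := by
  rw [← summable_nat_add_iff 7]
  refine Summable.of_nonneg_of_le (fun _ => abs_nonneg _) (fun j => ?_)
    (summable_factRatio_mul |fallingSeven t|)
  rw [choose_add_seven, abs_mul, abs_mul, abs_mul, abs_pow, abs_neg, abs_one, one_pow, one_mul,
    abs_of_nonneg (factRatio_nonneg j)]
  have := abs_risingProd_le ht j
  have := factRatio_nonneg j
  gcongr

theorem hasSum_d {t : ℝ} (ht : |6 - t| ≤ 3 / 10) :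
    HasSum (fun k => Ring.choose t k * momentDiff k) (d t / 6 ^ t) := by
  have hdiv : ∀ x, (Gm x ^ t - Gp x ^ t) / 6 ^ t
      = (1 + (signedG (-1) x / 6 - 1)) ^ t - (1 + (signedG 1 x / 6 - 1)) ^ t := by
    intro x
    have h1 := (signedG_pos (σ := -1) (by norm_num) x).le
    have h2 := (signedG_pos (σ := 1) (by norm_num) x).le
    rw [← signedG_one, ← signedG_neg_one, add_sub_cancel, add_sub_cancel,
      Real.div_rpow h1 (by norm_num), Real.div_rpow h2 (by norm_num)]
    ring
  rw [d, ← intervalIntegral.integral_div]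
  simp_rw [hdiv, ← momentDiff_eq_integral, ← intervalIntegral.integral_const_mul]
  have hc1 := continuous_signedG 1
  have hc2 := continuous_signedG (-1)
  refine intervalIntegral.hasSum_integral_of_dominated_convergence
    (fun k _ => |Ring.choose t k| * 2) (fun k => ?_) (fun k => ?_) ?_ ?_ ?_
  · exact Continuous.aestronglyMeasurable (by fun_prop)
  · refine Filter.Eventually.of_forall fun x _ => ?_
    rw [norm_mul, Real.norm_eq_abs]
    gcongr
    refine (norm_sub_le _ _).trans ?_
    rw [norm_pow, norm_pow, ← one_add_one_eq_two]
    exact add_le_add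
      (pow_le_one₀ (norm_nonneg _) (abs_signedG_div_sub_one_lt (.inr rfl) x).le)
      (pow_le_one₀ (norm_nonneg _) (abs_signedG_div_sub_one_lt (.inl rfl) x).le)
  · exact Filter.Eventually.of_forall fun x _ => (summable_abs_choose ht).mul_right 2
  · exact intervalIntegrable_const
  · refine Filter.Eventually.of_forall fun x _ => ?_
    simpa only [mul_sub] using
      (hasSum_choose_mul_pow t (abs_signedG_div_sub_one_lt (.inr rfl) x)).sub
        (hasSum_choose_mul_pow t (abs_signedG_div_sub_one_lt (.inl rfl) x))

theorem momentDiff_eq {k : ℕ} (hk : k < 27) :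
    momentDiff k = momentDiffs.getD k 0 / (2 * 6 ^ k) := by
  rw [← moment_sub_moment, momentDiff]
  simp [List.getD, hk]

theorem momentDiff_eq_zero {k : ℕ} (hk : k < 7) : momentDiff k = 0 := by
  rw [momentDiff_eq (by omega)]
  interval_cases k <;> simp [momentDiffs]

/-- `∑ j, (-1) ^ j * j! / (j + 7)! * momentDiff (j + 7) * p j s` for a sequence of functions `p`. -/
noncomputable def coeffSeries (p : ℕ → ℝ → ℝ) (s : ℝ) : ℝ :=
  ∑' j, (-1) ^ j * factRatio j * momentDiff (j + 7) * p j s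

theorem d_eq {t : ℝ} (ht : |6 - t| ≤ 3 / 10) :
    d t = 6 ^ t * (fallingSeven t * coeffSeries risingProd (6 - t)) := by
  have h := (hasSum_nat_add_iff' 7).2 (hasSum_d ht)
  rw [Finset.sum_eq_zero fun k hk => by
    rw [momentDiff_eq_zero (Finset.mem_range.1 hk), mul_zero], sub_zero] at h
  have h6 : (6 : ℝ) ^ t ≠ 0 := (Real.rpow_pos_of_pos (by norm_num) t).ne'
  rw [mul_comm, ← div_eq_iff h6, ← h.tsum_eq, coeffSeries, ← tsum_mul_left]
  congr 1 with j
  rw [choose_add_seven]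
  ring

theorem hasDerivAt_coeffSeries {p p' : ℕ → ℝ → ℝ} {c c' : ℝ}
    (hp : ∀ j s, HasDerivAt (p j) (p' j s) s)
    (hpc : ∀ {s : ℝ}, |s| ≤ 3 / 10 → ∀ j, |p j s| ≤ c * (j + 1))
    (hpc' : ∀ {s : ℝ}, |s| ≤ 3 / 10 → ∀ j, |p' j s| ≤ c' * (j + 1)) {s : ℝ} (hs : |s| < 3 / 10) :
    HasDerivAt (coeffSeries p) (coeffSeries p' s) s := by
  have hmem : ∀ {y : ℝ}, y ∈ Set.Ioo (-(3 / 10) : ℝ) (3 / 10) ↔ |y| < 3 / 10 := abs_lt.symm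
  have hsum : Summable fun j => (-1) ^ j * factRatio j * momentDiff (j + 7) * p j s :=
    Summable.of_norm_bounded (summable_factRatio_mul c) fun j => norm_coeff_mul_le (hpc hs.le j)
  exact hasDerivAt_tsum_of_isPreconnected
    (g := fun j y => (-1) ^ j * factRatio j * momentDiff (j + 7) * p j y)
    (g' := fun j y => (-1) ^ j * factRatio j * momentDiff (j + 7) * p' j y)
    (summable_factRatio_mul c') isOpen_Ioo isPreconnected_Ioo (fun j y _ => (hp j y).const_mul _)
    (fun j y hy => norm_coeff_mul_le (hpc' (hmem.1 hy).le j)) (hmem.2 hs) hsum (hmem.2 hs)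

theorem abs_coeffSeries_sub_le {p : ℕ → ℝ → ℝ} {c A s : ℝ} {n : ℕ}
    (hA : ∀ j, |momentDiff (j + n + 7)| ≤ A) (hp : ∀ j, |p j s| ≤ c * (j + 1)) :
    |coeffSeries p s - ∑ j ∈ Finset.range n, (-1) ^ j * factRatio j * momentDiff (j + 7) * p j s|
      ≤ c * (factTail n * A) := by
  have hsum : Summable fun j => (-1) ^ j * factRatio j * momentDiff (j + 7) * p j s :=
    Summable.of_norm_bounded (summable_factRatio_mul c) fun j => norm_coeff_mul_le (hp j)
  have hA0 : 0 ≤ A := (abs_nonneg _).trans (hA 0)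
  rw [coeffSeries, ← hsum.sum_add_tsum_nat_add n, add_sub_cancel_left, ← Real.norm_eq_abs,
    show c * (factTail n * A) = c * A * factTail n by ring]
  refine tsum_of_norm_bounded ((hasSum_factRatio_mul n).mul_left (c * A)) fun j => ?_
  have h1 := factRatio_nonneg (j + n)
  rw [Real.norm_eq_abs, abs_mul, abs_mul, abs_mul, abs_pow, abs_neg, abs_one, one_pow, one_mul,
    abs_of_nonneg h1]
  calc _ ≤ factRatio (j + n) * A * (c * ((j + n : ℕ) + 1)) := by
        gcongr
        · exact hA j
        · exact hp _
    _ = _ := by ring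

theorem abs_momentDiff_add_le (j : ℕ) :
    |momentDiff (j + 20 + 7)| ≤ 15353710942205813038 / (2 * 6 ^ 26) := by
  refine (abs_momentDiff_le (n := 26) (by decide) (by omega)).trans_eq ?_
  rw [← Int.cast_add, moment_add_moment]
  norm_num

theorem factTail_twenty_mul_le :
    factTail 20 * (15353710942205813038 / (2 * 6 ^ 26)) ≤ 115 / 10 ^ 11 := by
  norm_num [factTail, Nat.factorial]

/-- The first twenty terms of `coeffSeries p s`, with explicit rational coefficients. -/
noncomputable def coeffPartial (p : ℕ → ℝ → ℝ) (s : ℝ) : ℝ :=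
  ∑ j ∈ Finset.range 20,
    (-1) ^ j * factRatio j * (momentDiffs.getD (j + 7) 0 / (2 * 6 ^ (j + 7))) * p j s

theorem abs_coeffSeries_sub_coeffPartial_le {p : ℕ → ℝ → ℝ} {c s : ℝ}
    (hp : ∀ j, |p j s| ≤ c * (j + 1)) :
    |coeffSeries p s - coeffPartial p s| ≤ c * (115 / 10 ^ 11) := by
  have hc : 0 ≤ c := by simpa using (abs_nonneg _).trans (hp 0)
  have h : coeffPartial p s
      = ∑ j ∈ Finset.range 20, (-1) ^ j * factRatio j * momentDiff (j + 7) * p j s := by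
    refine Finset.sum_congr rfl fun j hj => ?_
    rw [momentDiff_eq (by have := Finset.mem_range.1 hj; omega)]
  rw [h]
  exact (abs_coeffSeries_sub_le abs_momentDiff_add_le hp).trans
    (mul_le_mul_of_nonneg_left factTail_twenty_mul_le hc)

theorem alternating_momentDiffs_nonneg :
    ∀ j < 19, 0 ≤ (-1) ^ (j + 1) * momentDiffs.getD (j + 1 + 7) 0 := by
  decide +kernel

theorem coeffPartial_mono {p : ℕ → ℝ → ℝ} {s s' : ℝ} (h0 : p 0 s = p 0 s')
    (h : ∀ j, p j s ≤ p j s') : coeffPartial p s ≤ coeffPartial p s' := by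
  refine Finset.sum_le_sum fun j hj => ?_
  cases j with
  | zero => rw [h0]
  | succ j =>
    refine mul_le_mul_of_nonneg_left (h _) ?_
    have h1 : (0 : ℝ) ≤ (-1) ^ (j + 1) * (momentDiffs.getD (j + 1 + 7) 0 : ℤ) := by
      exact_mod_cast alternating_momentDiffs_nonneg j
        (by have := Finset.mem_range.1 hj; omega)
    have h2 := factRatio_nonneg (j + 1)
    calc (0 : ℝ) ≤ factRatio (j + 1) * ((-1) ^ (j + 1) * (momentDiffs.getD (j + 1 + 7) 0 : ℤ))
            / (2 * 6 ^ (j + 1 + 7)) := by positivity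
      _ = _ := by ring

theorem coeffPartial_risingProd_le : coeffPartial risingProd (28 / 100) ≤ -74 / 10 ^ 10 := by
  norm_num [coeffPartial, Finset.sum_range_succ, momentDiffs, factRatio, Nat.factorial, risingProd]

theorem coeffPartial_risingProd₁_le : coeffPartial risingProd₁ (28 / 100) ≤ 393 / 10 ^ 11 := by
  norm_num [coeffPartial, Finset.sum_range_succ, momentDiffs, factRatio, Nat.factorial, risingProd,
    risingProd₁]

theorem coeffPartial_risingProd₂_le : coeffPartial risingProd₂ (28 / 100) ≤ 45 / 10 ^ 10 := by
  norm_num [coeffPartial, Finset.sum_range_succ, momentDiffs, factRatio, Nat.factorial, risingProd,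
    risingProd₁, risingProd₂]

theorem coeffPartial_nonneg {p : ℕ → ℝ → ℝ} {s : ℝ} (h0 : p 0 s = 0) (h : ∀ j, 0 ≤ p j s) :
    0 ≤ coeffPartial p s := by
  have := coeffPartial_mono (p := fun j y => if y = 0 then 0 else p j s) (s := 0) (s' := 1)
    (by simp [h0]) (by simpa using h)
  simpa [coeffPartial] using this

theorem coeffSeries_risingProd_le {s : ℝ} (h0 : 0 ≤ s) (h1 : s ≤ 28 / 100) :
    coeffSeries risingProd s ≤ -625 / 10 ^ 11 := by
  have hs : |s| ≤ 3 / 10 := by rw [abs_of_nonneg h0]; linarith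
  have h := abs_le.1 (abs_coeffSeries_sub_coeffPartial_le (p := risingProd) (c := 1)
    (fun j => by simpa using abs_risingProd_le hs j))
  have h2 := coeffPartial_mono (p := risingProd) (s := s) (s' := 28 / 100) rfl
    fun j => (risingProd_mono h0 h1 j).2
  have h3 := coeffPartial_risingProd_le
  norm_num at h h2 h3 ⊢
  linarith [h.2]

theorem coeffSeries_risingProd₁_mem {s : ℝ} (h0 : 0 ≤ s) (h1 : s ≤ 28 / 100) :
    coeffSeries risingProd₁ s ∈ Set.Icc (-165 / 10 ^ 11) (558 / 10 ^ 11) := by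
  have hs : |s| ≤ 3 / 10 := by rw [abs_of_nonneg h0]; linarith
  have h := abs_le.1 (abs_coeffSeries_sub_coeffPartial_le (p := risingProd₁)
    (abs_risingProd₁_le hs))
  have h2 := coeffPartial_mono (p := risingProd₁) (s := s) (s' := 28 / 100) rfl
    fun j => (risingProd₁_mono h0 h1 j).2
  have h3 := coeffPartial_risingProd₁_le
  have h4 := coeffPartial_nonneg (p := risingProd₁) rfl fun j => (risingProd₁_mono h0 h1 j).1
  norm_num at h h2 h3 ⊢
  constructor <;> linarith [h.1, h.2]

theorem abs_coeffSeries_risingProd₂_le {s : ℝ} (h0 : 0 ≤ s) (h1 : s ≤ 28 / 100) :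
    |coeffSeries risingProd₂ s| ≤ 92 / 10 ^ 10 := by
  have hs : |s| ≤ 3 / 10 := by rw [abs_of_nonneg h0]; linarith
  have h := abs_le.1 (abs_coeffSeries_sub_coeffPartial_le (p := risingProd₂)
    (abs_risingProd₂_le hs))
  have h2 := coeffPartial_mono (p := risingProd₂) (s := s) (s' := 28 / 100) rfl
    fun j => (risingProd₂_mono h0 h1 j).2
  have h3 := coeffPartial_risingProd₂_le
  have h4 := coeffPartial_nonneg (p := risingProd₂) rfl fun j => (risingProd₂_mono h0 h1 j).1
  rw [abs_le]
  norm_num at h h2 h3 ⊢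
  constructor <;> linarith [h.1, h.2]

/-- The first derivative of `fallingSeven`. -/
noncomputable def fallingSeven₁ (t : ℝ) : ℝ :=
  7 * t ^ 6 - 126 * t ^ 5 + 875 * t ^ 4 - 2940 * t ^ 3 + 4872 * t ^ 2 - 3528 * t + 720

/-- The second derivative of `fallingSeven`. -/
noncomputable def fallingSeven₂ (t : ℝ) : ℝ :=
  42 * t ^ 5 - 630 * t ^ 4 + 3500 * t ^ 3 - 8820 * t ^ 2 + 9744 * t - 3528

theorem hasDerivAt_fallingSeven (t : ℝ) : HasDerivAt fallingSeven (fallingSeven₁ t) t := by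
  have h : HasDerivAt (fun t : ℝ => t ^ 7 - 21 * t ^ 6 + 175 * t ^ 5 - 735 * t ^ 4 + 1624 * t ^ 3
      - 1764 * t ^ 2 + 720 * t) (fallingSeven₁ t) t := by
    have hp := fun n => hasDerivAt_pow n t
    refine ((((((hp 7).sub ((hp 6).const_mul 21)).add ((hp 5).const_mul 175)).sub
      ((hp 4).const_mul 735)).add ((hp 3).const_mul 1624)).sub ((hp 2).const_mul 1764)).add
      ((hasDerivAt_id t).const_mul 720) |>.congr_deriv ?_
    simp only [fallingSeven₁]; push_cast; ring
  refine h.congr_of_eventuallyEq (.of_forall fun t => ?_)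
  simp only [fallingSeven]; ring

theorem hasDerivAt_fallingSeven₁ (t : ℝ) : HasDerivAt fallingSeven₁ (fallingSeven₂ t) t := by
  have hp := fun n => hasDerivAt_pow n t
  refine ((((((hp 6).const_mul 7).sub ((hp 5).const_mul 126)).add ((hp 4).const_mul 875)).sub
    ((hp 3).const_mul 2940)).add ((hp 2).const_mul 4872)).sub
    ((hasDerivAt_id t).const_mul 3528) |>.add_const 720 |>.congr_deriv ?_
  simp only [fallingSeven₂]; push_cast; ring

theorem fallingSeven_bounds {t : ℝ} (h0 : 5.72 ≤ t) (h1 : t ≤ 6) :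
    (-95 ≤ fallingSeven t ∧ fallingSeven t ≤ 0) ∧
      (54 ≤ fallingSeven₁ t ∧ fallingSeven₁ t ≤ 720) ∧ 1400 ≤ fallingSeven₂ t := by
  obtain ⟨u, rfl⟩ : ∃ u, t = 5.72 + u := ⟨t - 5.72, by ring⟩
  have hu : 0 ≤ u := by linarith
  have hu' : u ≤ 0.28 := by norm_num at h1 ⊢; linarith
  have p2 := pow_nonneg hu 2
  have p3 := pow_nonneg hu 3
  have p4 := pow_nonneg hu 4
  have p5 := pow_nonneg hu 5
  have p6 := pow_nonneg hu 6
  have p7 := pow_nonneg hu 7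
  have q2 := pow_le_pow_left₀ hu hu' 2
  have q3 := pow_le_pow_left₀ hu hu' 3
  have q4 := pow_le_pow_left₀ hu hu' 4
  have q5 := pow_le_pow_left₀ hu hu' 5
  have q6 := pow_le_pow_left₀ hu hu' 6
  have hneg : fallingSeven (5.72 + u) ≤ 0 := by
    have a0 : 0 ≤ 5.72 + u := by linarith
    have a1 : 0 ≤ 5.72 + u - 1 := by linarith
    have a2 : 0 ≤ 5.72 + u - 2 := by linarith
    have a3 : 0 ≤ 5.72 + u - 3 := by linarith
    have a4 : 0 ≤ 5.72 + u - 4 := by linarith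
    have a5 : 0 ≤ 5.72 + u - 5 := by linarith
    exact mul_nonpos_of_nonneg_of_nonpos (by positivity) (by linarith)
  refine ⟨⟨?_, hneg⟩, ⟨?_, ?_⟩, ?_⟩ <;> norm_num [fallingSeven, fallingSeven₁, fallingSeven₂] at * <;>
    ring_nf <;> linarith

/-- The first derivative of `d` near `6`, divided by `6 ^ t`. -/
noncomputable def derivFactor (t : ℝ) : ℝ :=
  (log 6 * fallingSeven t + fallingSeven₁ t) * coeffSeries risingProd (6 - t)
    - fallingSeven t * coeffSeries risingProd₁ (6 - t)

/-- The second derivative of `d` near `6`, divided by `6 ^ t`. -/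
noncomputable def derivFactor₂ (t : ℝ) : ℝ :=
  (log 6 ^ 2 * fallingSeven t + 2 * log 6 * fallingSeven₁ t + fallingSeven₂ t)
      * coeffSeries risingProd (6 - t)
    - 2 * (log 6 * fallingSeven t + fallingSeven₁ t) * coeffSeries risingProd₁ (6 - t)
    + fallingSeven t * coeffSeries risingProd₂ (6 - t)

theorem hasDerivAt_coeffSeries_risingProd {t : ℝ} (ht : |6 - t| < 3 / 10) :
    HasDerivAt (fun t => coeffSeries risingProd (6 - t)) (-coeffSeries risingProd₁ (6 - t)) t := by
  have h := hasDerivAt_coeffSeries (c := 1) hasDerivAt_risingProd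
    (fun hs j => by simpa using abs_risingProd_le hs j) abs_risingProd₁_le ht
  refine (h.comp t ((hasDerivAt_id t).const_sub 6)).congr_deriv ?_
  ring

theorem hasDerivAt_coeffSeries_risingProd₁ {t : ℝ} (ht : |6 - t| < 3 / 10) :
    HasDerivAt (fun t => coeffSeries risingProd₁ (6 - t)) (-coeffSeries risingProd₂ (6 - t)) t := by
  have h := hasDerivAt_coeffSeries hasDerivAt_risingProd₁ abs_risingProd₁_le abs_risingProd₂_le ht
  refine (h.comp t ((hasDerivAt_id t).const_sub 6)).congr_deriv ?_
  ring

theorem eventually_abs_six_sub_lt {t : ℝ} (ht : |6 - t| < 3 / 10) :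
    ∀ᶠ y in nhds t, |6 - y| < 3 / 10 :=
  (continuous_const.sub continuous_id).abs.continuousAt.eventually_lt_const ht

theorem hasDerivAt_d {t : ℝ} (ht : |6 - t| < 3 / 10) :
    HasDerivAt d (6 ^ t * derivFactor t) t := by
  have h := ((hasDerivAt_id t).const_rpow (show (0 : ℝ) < 6 by norm_num)).mul
    ((hasDerivAt_fallingSeven t).mul (hasDerivAt_coeffSeries_risingProd ht))
  refine (h.congr_deriv ?_).congr_of_eventuallyEq ?_
  · simp only [derivFactor, id, Pi.mul_apply]; ring
  · filter_upwards [eventually_abs_six_sub_lt ht] with y hy using d_eq hy.le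

theorem iteratedDeriv_two_d {t : ℝ} (ht : |6 - t| < 3 / 10) :
    iteratedDeriv 2 d t = 6 ^ t * derivFactor₂ t := by
  have hU := hasDerivAt_coeffSeries_risingProd ht
  have hU₁ := hasDerivAt_coeffSeries_risingProd₁ ht
  have hq := hasDerivAt_fallingSeven t
  have h := ((hasDerivAt_id t).const_rpow (show (0 : ℝ) < 6 by norm_num)).mul
    ((((hq.const_mul (log 6)).add (hasDerivAt_fallingSeven₁ t)).mul hU).sub (hq.mul hU₁))
  rw [iteratedDeriv_succ, iteratedDeriv_one]
  refine HasDerivAt.deriv ((h.congr_deriv ?_).congr_of_eventuallyEq ?_)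
  · simp only [derivFactor₂, id, Pi.add_apply, Pi.sub_apply, Pi.mul_apply]; ring
  · filter_upwards [eventually_abs_six_sub_lt ht] with y hy using (hasDerivAt_d hy).deriv

theorem log_six_mem : log 6 ∈ Set.Icc 1.79 1.8 := by
  have h : log 6 = log 2 + log 3 := by
    rw [← Real.log_mul (by norm_num) (by norm_num)]; norm_num
  have h1 := Real.log_two_gt_d9
  have h2 := Real.log_two_lt_d9
  have h3 := Real.log_three_gt_d9
  have h4 := Real.log_three_lt_d9
  rw [h]
  constructor <;> norm_num at * <;> linarith

theorem derivFactor₂_neg {t : ℝ} (h0 : 5.72 ≤ t) (h1 : t ≤ 6) : derivFactor₂ t < 0 := by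
  obtain ⟨⟨q0, q1⟩, ⟨r0, r1⟩, w0⟩ := fallingSeven_bounds h0 h1
  obtain ⟨l0, l1⟩ := log_six_mem
  have hs0 : 0 ≤ 6 - t := by linarith
  have hs1 : 6 - t ≤ 28 / 100 := by norm_num at h0; linarith
  have hU := coeffSeries_risingProd_le hs0 hs1
  obtain ⟨u0, u1⟩ := coeffSeries_risingProd₁_mem hs0 hs1
  obtain ⟨v0, v1⟩ := abs_le.1 (abs_coeffSeries_risingProd₂_le hs0 hs1)
  unfold derivFactor₂
  set q := fallingSeven t
  set r := fallingSeven₁ t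
  set w := fallingSeven₂ t
  set L := log 6
  set U := coeffSeries risingProd (6 - t)
  set V := coeffSeries risingProd₁ (6 - t)
  set W := coeffSeries risingProd₂ (6 - t)
  norm_num at l0 l1 hU u0 u1 v0 v1
  have hLq : -171 ≤ L * q ∧ L * q ≤ 0 := ⟨by nlinarith, by nlinarith⟩
  have hLLq : -308 ≤ L ^ 2 * q := by nlinarith
  have hLr : 96 ≤ L * r := by nlinarith
  have hB : 1284 ≤ L ^ 2 * q + 2 * L * r + w := by linarith
  have hC0 : -117 ≤ L * q + r := by linarith
  have hC1 : L * q + r ≤ 720 := by linarith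
  have t1 : (L ^ 2 * q + 2 * L * r + w) * U ≤ 1284 * (-1 / 160000000) := by nlinarith
  have t2 : -(2 * (L * q + r) * V) ≤ 24 / 10 ^ 7 := by
    norm_num
    rcases le_total 0 (L * q + r) with h | h <;> nlinarith
  have t3 : q * W ≤ 88 / 10 ^ 8 := by norm_num; nlinarith
  norm_num at t2 t3
  linarith

theorem stmt15 : ∀ t : ℝ, 5.72 ≤ t → t ≤ 6 → iteratedDeriv 2 d t < 0 := by
  intro t h0 h1
  have ht : |6 - t| < 3 / 10 := by
    norm_num at h0
    rw [abs_lt]; constructor <;> linarith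
  rw [iteratedDeriv_two_d ht]
  exact mul_neg_of_pos_of_neg (Real.rpow_pos_of_pos (by norm_num) t) (derivFactor₂_neg h0 h1)
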